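/- Let k be a positive integer, let a_0, b_0 > 0 and a_1, …, a_k, b_1, …, b_k > 0, set a(x) = a_0·∏_{j=1}^k (x + a_j) and b(x) = b_0·∏_{j=1}^k (x + b_j) for x ≥ 0, and assume the interlacing condition b_1 ≤ a_1 ≤ b_2 ≤ a_2 ≤ … ≤ b_k ≤ a_k. Let F ⊆ {1, …, k} and G ⊆ {2, …, k} be (possibly empty) subsets, and let c be either of the polynomials c(x) = ∏_{j ∈ F} (x + a_j) or c(x) = ∏_{j ∈ G} (x + b_j). Then the double net {c(m)/(b(m) + a(m)·n)}_{m,n ∈ ℤ₊} is a minimal joint completely monotone net. -/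

import Mathlib

noncomputable section

/-- Forward difference operator for sequences. -/
def dSeq (s : ℕ → ℝ) : ℕ → ℝ := fun m => s (m + 1) - s m

/-- A sequence is completely monotone. -/
def CompMono (s : ℕ → ℝ) : Prop := ∀ k m : ℕ, 0 ≤ (-1 : ℝ) ^ k * dSeq^[k] s m

/-- A completely monotone sequence is minimal. -/
def MinCompMono (s : ℕ → ℝ) : Prop :=
  CompMono s ∧ ∀ ε : ℝ, 0 < ε → ¬ CompMono (fun k => s k - if k = 0 then ε else 0)

/-- First forward difference operator for double nets. -/
def d1 (a : ℕ → ℕ → ℝ) : ℕ → ℕ → ℝ := fun m n => a (m + 1) n - a m n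

/-- Second forward difference operator for double nets. -/
def d2 (a : ℕ → ℕ → ℝ) : ℕ → ℕ → ℝ := fun m n => a m (n + 1) - a m n

/-- A double net is joint completely monotone. -/
def JointCompMono (a : ℕ → ℕ → ℝ) : Prop :=
  ∀ β₁ β₂ m n : ℕ, 0 ≤ (-1 : ℝ) ^ (β₁ + β₂) * d1^[β₁] (d2^[β₂] a) m n

/-- A joint completely monotone double net is minimal. -/
def MinJointCompMono (a : ℕ → ℕ → ℝ) : Prop :=
  JointCompMono a ∧
    (∀ ε : ℝ, 0 < ε → ¬ CompMono (fun k => a k 0 - if k = 0 then ε else 0)) ∧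
    (∀ ε : ℝ, 0 < ε → ¬ CompMono (fun k => a 0 k - if k = 0 then ε else 0))

open Filter Topology

/-- Backward difference operator, the negative of `dSeq`. -/
def nabla (s : ℕ → ℝ) : ℕ → ℝ := fun m => s m - s (m + 1)

theorem nabla_iterate_succ (k : ℕ) (s : ℕ → ℝ) (m : ℕ) :
    nabla^[k + 1] s m = nabla^[k] s m - nabla^[k] s (m + 1) := by
  rw [Function.iterate_succ_apply']; rfl

theorem neg_one_pow_mul_dSeq_iterate (k : ℕ) (s : ℕ → ℝ) (m : ℕ) :
    (-1 : ℝ) ^ k * dSeq^[k] s m = nabla^[k] s m := by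
  induction k generalizing m with
  | zero => simp
  | succ k ih =>
    rw [nabla_iterate_succ, ← ih, ← ih, Function.iterate_succ_apply', dSeq]
    ring

theorem compMono_iff {s : ℕ → ℝ} : CompMono s ↔ ∀ k m : ℕ, 0 ≤ nabla^[k] s m := by
  simp only [CompMono, neg_one_pow_mul_dSeq_iterate]

theorem nabla_iterate_add (k : ℕ) (s t : ℕ → ℝ) (m : ℕ) :
    nabla^[k] (fun i => s i + t i) m = nabla^[k] s m + nabla^[k] t m := by
  induction k generalizing m with
  | zero => rfl
  | succ k ih => simp only [nabla_iterate_succ, ih]; ring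

theorem nabla_iterate_const_mul (k : ℕ) (r : ℝ) (s : ℕ → ℝ) (m : ℕ) :
    nabla^[k] (fun i => r * s i) m = r * nabla^[k] s m := by
  induction k generalizing m with
  | zero => rfl
  | succ k ih => simp only [nabla_iterate_succ, ih]; ring

/-- Complete monotonicity up to a given order. -/
def CompMonoUpTo : ℕ → (ℕ → ℝ) → Prop
  | 0, s => ∀ m, 0 ≤ s m
  | N + 1, s => (∀ m, 0 ≤ s m) ∧ CompMonoUpTo N (nabla s)

theorem compMono_iff_upTo {s : ℕ → ℝ} : CompMono s ↔ ∀ N, CompMonoUpTo N s := by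
  rw [compMono_iff]
  constructor
  · intro h N
    induction N generalizing s with
    | zero => exact h 0
    | succ N ih => exact ⟨h 0, ih fun k m => h (k + 1) m⟩
  · intro h k
    induction k generalizing s with
    | zero => exact h 0
    | succ k ih => exact ih fun N => (h (N + 1)).2

namespace CompMonoUpTo

theorem nonneg {N : ℕ} {s : ℕ → ℝ} (h : CompMonoUpTo N s) (m : ℕ) : 0 ≤ s m := by
  cases N with
  | zero => exact h m
  | succ N => exact h.1 m

theorem of_succ {N : ℕ} {s : ℕ → ℝ} (h : CompMonoUpTo (N + 1) s) : CompMonoUpTo N s := by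
  induction N generalizing s with
  | zero => exact h.1
  | succ N ih => exact ⟨h.1, ih h.2⟩

theorem shift {N : ℕ} {s : ℕ → ℝ} (h : CompMonoUpTo N s) :
    CompMonoUpTo N (fun m => s (m + 1)) := by
  induction N generalizing s with
  | zero => exact fun m => h (m + 1)
  | succ N ih => exact ⟨fun m => h.1 (m + 1), ih h.2⟩

theorem add {N : ℕ} {s t : ℕ → ℝ} (hs : CompMonoUpTo N s) (ht : CompMonoUpTo N t) :
    CompMonoUpTo N (fun m => s m + t m) := by
  induction N generalizing s t with
  | zero => exact fun m => add_nonneg (hs m) (ht m)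
  | succ N ih =>
    refine ⟨fun m => add_nonneg (hs.1 m) (ht.1 m), ?_⟩
    convert ih hs.2 ht.2 using 1
    funext m
    simp only [nabla]
    ring

theorem mul {N : ℕ} {s t : ℕ → ℝ} (hs : CompMonoUpTo N s) (ht : CompMonoUpTo N t) :
    CompMonoUpTo N (fun m => s m * t m) := by
  induction N generalizing s t with
  | zero => exact fun m => mul_nonneg (hs m) (ht m)
  | succ N ih =>
    refine ⟨fun m => mul_nonneg (hs.1 m) (ht.1 m), ?_⟩
    convert (ih hs.2 ht.of_succ).add (ih hs.of_succ.shift ht.2) using 1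
    funext m
    simp only [nabla]
    ring

end CompMonoUpTo

namespace CompMono

theorem nonneg {s : ℕ → ℝ} (h : CompMono s) (m : ℕ) : 0 ≤ s m :=
  (compMono_iff_upTo.1 h 0).nonneg m

theorem add {s t : ℕ → ℝ} (hs : CompMono s) (ht : CompMono t) :
    CompMono (fun m => s m + t m) :=
  compMono_iff_upTo.2 fun N => (compMono_iff_upTo.1 hs N).add (compMono_iff_upTo.1 ht N)

theorem mul {s t : ℕ → ℝ} (hs : CompMono s) (ht : CompMono t) :
    CompMono (fun m => s m * t m) :=
  compMono_iff_upTo.2 fun N => (compMono_iff_upTo.1 hs N).mul (compMono_iff_upTo.1 ht N)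

theorem nabla {s : ℕ → ℝ} (hs : CompMono s) : CompMono (nabla s) :=
  compMono_iff_upTo.2 fun N => (compMono_iff_upTo.1 hs (N + 1)).2

theorem const {r : ℝ} (hr : 0 ≤ r) : CompMono (fun _ => r) := by
  refine compMono_iff_upTo.2 fun N => ?_
  induction N generalizing r with
  | zero => exact fun _ => hr
  | succ N ih =>
    refine ⟨fun _ => hr, ?_⟩
    convert ih le_rfl using 1
    funext m
    simp [_root_.nabla]

theorem const_mul {r : ℝ} (hr : 0 ≤ r) {s : ℕ → ℝ} (hs : CompMono s) :
    CompMono (fun m => r * s m) :=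
  (const hr).mul hs

theorem prod {ι : Type*} (S : Finset ι) {s : ι → ℕ → ℝ} (h : ∀ j ∈ S, CompMono (s j)) :
    CompMono (fun m => ∏ j ∈ S, s j m) := by
  classical
  induction S using Finset.induction_on with
  | empty => simpa using const zero_le_one
  | insert i S hi ih =>
    simp only [Finset.prod_insert hi]
    exact (h i (by simp)).mul (ih fun j hj => h j (by simp [hj]))

/-- The reciprocal of a positive discrete Bernstein function is completely monotone. -/
theorem inv {ψ : ℕ → ℝ} (hpos : ∀ m, 0 < ψ m) (hψ : CompMono (dSeq ψ)) :
    CompMono (fun m => (ψ m)⁻¹) := by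
  refine compMono_iff_upTo.2 fun N => ?_
  induction N with
  | zero => exact fun m => (inv_pos.2 (hpos m)).le
  | succ N ih =>
    refine ⟨fun m => (inv_pos.2 (hpos m)).le, ?_⟩
    convert ((compMono_iff_upTo.1 hψ N).mul ih).mul ih.shift using 1
    funext m
    have h₁ := (hpos m).ne'
    have h₂ := (hpos (m + 1)).ne'
    simp only [_root_.nabla, dSeq]
    field_simp

theorem inv_add {β : ℝ} (hβ : 0 < β) : CompMono (fun m : ℕ => ((m : ℝ) + β)⁻¹) := by
  refine inv (fun m => by positivity) ?_
  convert const zero_le_one using 1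
  funext m
  simp [dSeq]

end CompMono

/-- The convex cone generated by the sequences `m ↦ 1 / (m + a)` with `0 < a ≤ t`. -/
inductive PoleCone (t : ℝ) : (ℕ → ℝ) → Prop
  | zero : PoleCone t (fun _ => 0)
  | add_pole (g : ℕ → ℝ) (r a : ℝ) (hr : 0 ≤ r) (ha : 0 < a) (hat : a ≤ t)
      (hg : PoleCone t g) : PoleCone t (fun m => g m + r * ((m : ℝ) + a)⁻¹)

namespace PoleCone

theorem compMono {t : ℝ} {g : ℕ → ℝ} (h : PoleCone t g) : CompMono g := by
  induction h with
  | zero => exact CompMono.const le_rfl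
  | add_pole g r a hr ha _ _ ih => exact ih.add ((CompMono.inv_add ha).const_mul hr)

theorem mul_ratio {t : ℝ} {g : ℕ → ℝ} (h : PoleCone t g) {b a : ℝ} (ht : t ≤ b) (hba : b ≤ a)
    (ha : 0 < a) : PoleCone a (fun m => g m * (((m : ℝ) + b) / ((m : ℝ) + a))) := by
  induction h with
  | zero => simpa using PoleCone.zero
  | add_pole g r p hr hp hpt _ ih =>
    rcases (hpt.trans (ht.trans hba)).eq_or_lt with rfl | hlt
    · obtain rfl : b = p := by linarith
      convert PoleCone.add_pole _ r b hr hp le_rfl ih using 1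
      funext m
      have : (0 : ℝ) < m + b := by positivity
      field_simp
    · have hd : 0 < a - p := by linarith
      convert PoleCone.add_pole _ (r * ((a - b) / (a - p))) a
        (mul_nonneg hr (div_nonneg (by linarith) hd.le)) ha le_rfl
        (PoleCone.add_pole _ (r * ((b - p) / (a - p))) p
          (mul_nonneg hr (div_nonneg (by linarith) hd.le)) hp hlt.le ih) using 1
      funext m
      have h₁ : (m : ℝ) + p ≠ 0 := by positivity
      have h₂ : (m : ℝ) + a ≠ 0 := by positivity
      field_simp
      ring

theorem exists_prod_ratio (k : ℕ) (A B : ℕ → ℝ)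
    (hA : ∀ j, 1 ≤ j → j ≤ k → 0 < A j)
    (hBA : ∀ j, 1 ≤ j → j ≤ k → B j ≤ A j)
    (hAB : ∀ j, 1 ≤ j → j < k → A j ≤ B (j + 1)) :
    ∃ g t, PoleCone t g ∧ (0 < k → t = A k) ∧ (k = 0 → g = fun _ => 0) ∧ ∀ m : ℕ,
      ∏ j ∈ Finset.Icc 1 k, (((m : ℝ) + B j) / ((m : ℝ) + A j)) = 1 - g m := by
  induction k with
  | zero => exact ⟨_, 0, PoleCone.zero, by simp, by simp, by simp⟩
  | succ k ih =>
    obtain ⟨g, t, hg, ht, hg0, hprod⟩ := ih (fun j h₁ h₂ => hA j h₁ (by omega))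
      (fun j h₁ h₂ => hBA j h₁ (by omega)) (fun j h₁ h₂ => hAB j h₁ (by omega))
    have hpos := hA (k + 1) (by omega) le_rfl
    have hle := hBA (k + 1) (by omega) le_rfl
    have hcone : PoleCone (A (k + 1))
        (fun m : ℕ => g m * (((m : ℝ) + B (k + 1)) / ((m : ℝ) + A (k + 1)))) := by
      rcases Nat.eq_zero_or_pos k with hk | hk
      · rw [hg0 hk]
        simpa using PoleCone.zero
      · exact hg.mul_ratio (ht hk ▸ hAB k hk (by omega)) hle hpos
    refine ⟨_, _, PoleCone.add_pole _ (A (k + 1) - B (k + 1)) (A (k + 1)) (by linarith) hpos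
      le_rfl hcone, by simp, by simp, fun m => ?_⟩
    rw [Finset.prod_Icc_succ_top (by omega), hprod]
    have : (m : ℝ) + A (k + 1) ≠ 0 := by positivity
    field_simp
    ring

end PoleCone

/-- Completely monotone sequences whose representing measure has no atom at the origin. -/
def VanishingCompMono (s : ℕ → ℝ) : Prop :=
  CompMono s ∧ Tendsto (fun k => nabla^[k] s 0) atTop (𝓝 0)

theorem nabla_iterate_linear_mul (k : ℕ) (β : ℝ) (g : ℕ → ℝ) (m : ℕ) :
    nabla^[k + 1] (fun i : ℕ => ((i : ℝ) + β) * g i) m =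
      ((m : ℝ) + k + 1 + β) * nabla^[k + 1] g m - (k + 1) * nabla^[k] g m := by
  induction k generalizing m with
  | zero =>
    simp only [Function.iterate_succ, Function.iterate_zero, Function.comp, id, nabla]
    push_cast
    ring
  | succ k ih =>
    rw [nabla_iterate_succ (k + 1), ih, ih, nabla_iterate_succ (k + 1) g]
    simp only [nabla_iterate_succ k g]
    push_cast
    ring

theorem tendsto_zero_of_recurrence {β : ℝ} (hβ : 0 < β) {u v : ℕ → ℝ} (hu : Antitone u)
    (hu0 : ∀ k, 0 ≤ u k) (hv : Tendsto v atTop (𝓝 0))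
    (h : ∀ k : ℕ, ((k : ℝ) + 1 + β) * u (k + 1) = v (k + 1) + (k + 1) * u k) :
    Tendsto u atTop (𝓝 0) := by
  have hlim := tendsto_atTop_ciInf hu ⟨0, by rintro _ ⟨k, rfl⟩; exact hu0 k⟩
  set L := ⨅ k, u k with hL
  have hLle : ∀ k, L ≤ u k := fun k => hu.le_of_tendsto hlim k
  have hL0 : 0 ≤ L := ge_of_tendsto' hlim hu0
  rcases hL0.eq_or_lt with h0 | hpos
  · rwa [← h0] at hlim
  exfalso
  have hsum : Summable (fun k => u k - u (k + 1)) := by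
    refine summable_of_sum_range_le (c := u 0) (fun k => sub_nonneg.2 (hu k.le_succ)) fun n => ?_
    rw [Finset.sum_range_sub']
    linarith [hu0 n]
  have hsmall : ∀ᶠ k in atTop, v (k + 1) < β * L / 2 :=
    (hv.comp (tendsto_add_atTop_nat 1)).eventually_lt_const (by positivity)
  refine Real.not_summable_one_div_natCast ((summable_nat_add_iff 1).1 ?_)
  refine Summable.of_norm_bounded_eventually_nat (hsum.mul_left (2 / (β * L))) ?_
  filter_upwards [hsmall] with k hk
  have hk1 : (0 : ℝ) < (k : ℝ) + 1 := by positivity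
  have hbound : β * L / 2 ≤ (k + 1) * (u k - u (k + 1)) := by
    nlinarith [h k, mul_le_mul_of_nonneg_left (hLle (k + 1)) hβ.le]
  rw [Real.norm_of_nonneg (by positivity)]
  push_cast
  rw [div_le_iff₀ hk1, div_mul_eq_mul_div, div_mul_eq_mul_div, le_div_iff₀ (by positivity)]
  linarith

namespace VanishingCompMono

theorem const {r : ℝ} (hr : 0 ≤ r) : VanishingCompMono (fun _ => r) := by
  refine ⟨CompMono.const hr, tendsto_const_nhds.congr' ?_⟩
  filter_upwards [eventually_ge_atTop 1] with k hk
  obtain ⟨k, rfl⟩ := Nat.exists_eq_add_of_le' hk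
  have : ∀ k m, nabla^[k + 1] (fun _ => r) m = 0 := by
    intro k
    induction k with
    | zero => simp [nabla]
    | succ k ih => intro m; rw [nabla_iterate_succ, ih, ih, sub_zero]
  exact (this k 0).symm

theorem add {s t : ℕ → ℝ} (hs : VanishingCompMono s) (ht : VanishingCompMono t) :
    VanishingCompMono (fun m => s m + t m) := by
  refine ⟨hs.1.add ht.1, ?_⟩
  simpa only [nabla_iterate_add, add_zero] using hs.2.add ht.2

theorem const_mul {r : ℝ} (hr : 0 ≤ r) {s : ℕ → ℝ} (hs : VanishingCompMono s) :
    VanishingCompMono (fun m => r * s m) := by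
  refine ⟨hs.1.const_mul hr, ?_⟩
  simpa only [nabla_iterate_const_mul, mul_zero] using hs.2.const_mul r

theorem mul_inv_add {s : ℕ → ℝ} (hs : VanishingCompMono s) {β : ℝ} (hβ : 0 < β) :
    VanishingCompMono (fun m => s m * ((m : ℝ) + β)⁻¹) := by
  have hcm := hs.1.mul (CompMono.inv_add hβ)
  have hnn := compMono_iff.1 hcm
  refine ⟨hcm, tendsto_zero_of_recurrence hβ (antitone_nat_of_succ_le fun k => ?_)
    (fun k => hnn k 0) hs.2 fun k => ?_⟩
  · rw [nabla_iterate_succ]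
    linarith [hnn k 1]
  · have h := nabla_iterate_linear_mul k β (fun m => s m * ((m : ℝ) + β)⁻¹) 0
    have hs' : (fun i : ℕ => ((i : ℝ) + β) * (s i * ((i : ℝ) + β)⁻¹)) = s := by
      funext i
      have : (i : ℝ) + β ≠ 0 := by positivity
      field_simp
    rw [hs'] at h
    push_cast at h
    linarith

/-- Products of factors `(m + α) / (m + β)` and `1 / (m + β)` with `0 < β ≤ α`. -/
theorem prod_ratio (S : Finset ℕ) (P : ℕ → Prop) [DecidablePred P] (α β : ℕ → ℝ)
    (hβ : ∀ j ∈ S, 0 < β j) (hαβ : ∀ j ∈ S, P j → β j ≤ α j) :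
    VanishingCompMono
      (fun m : ℕ => ∏ j ∈ S, (if P j then (m : ℝ) + α j else 1) / ((m : ℝ) + β j)) := by
  induction S using Finset.induction_on with
  | empty => simpa using const zero_le_one
  | insert i S hi ih =>
    have hi' := ih (fun j hj => hβ j (by simp [hj])) (fun j hj => hαβ j (by simp [hj]))
    have hpos := hβ i (by simp)
    simp only [Finset.prod_insert hi]
    by_cases hP : P i
    · have hle := hαβ i (by simp) hP
      convert hi'.add ((hi'.mul_inv_add hpos).const_mul (sub_nonneg.2 hle)) using 1
      funext m
      have : (m : ℝ) + β i ≠ 0 := by positivity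
      simp only [hP, if_true]
      field_simp
      ring
    · convert hi'.mul_inv_add hpos using 1
      funext m
      simp only [hP, if_false]
      ring

theorem not_compMono_sub {s : ℕ → ℝ} (hs : VanishingCompMono s) {ε : ℝ} (hε : 0 < ε) :
    ¬ CompMono (fun k => s k - if k = 0 then ε else 0) := by
  intro h
  have key : ∀ k, nabla^[k] (fun k => s k - if k = 0 then ε else 0) 0 = nabla^[k] s 0 - ε ∧
      ∀ m, nabla^[k] (fun k => s k - if k = 0 then ε else 0) (m + 1) = nabla^[k] s (m + 1) := by
    intro k
    induction k with
    | zero => simp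
    | succ k ih =>
      refine ⟨?_, fun m => ?_⟩
      · rw [nabla_iterate_succ, nabla_iterate_succ, ih.1, ih.2]
        ring
      · rw [nabla_iterate_succ, nabla_iterate_succ, ih.2, ih.2]
  have : ε ≤ 0 := ge_of_tendsto' hs.2 fun k => by
    linarith [compMono_iff.1 h k 0, (key k).1]
  linarith

end VanishingCompMono

theorem d2_iterate (β : ℕ) (a : ℕ → ℕ → ℝ) : d2^[β] a = fun m => dSeq^[β] (a m) := by
  induction β with
  | zero => rfl
  | succ β ih =>
    rw [Function.iterate_succ_apply', ih]
    funext m n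
    rw [Function.iterate_succ_apply']
    rfl

theorem d1_iterate (β : ℕ) (a : ℕ → ℕ → ℝ) (m n : ℕ) :
    d1^[β] a m n = dSeq^[β] (fun i => a i n) m := by
  induction β generalizing m with
  | zero => rfl
  | succ β ih => rw [Function.iterate_succ_apply', Function.iterate_succ_apply', d1, ih, ih, dSeq]

theorem dSeq_iterate_const_mul (k : ℕ) (r : ℝ) (s : ℕ → ℝ) (m : ℕ) :
    dSeq^[k] (fun i => r * s i) m = r * dSeq^[k] s m := by
  induction k generalizing m with
  | zero => rfl
  | succ k ih => simp only [Function.iterate_succ_apply', dSeq, ih]; ring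

theorem jointCompMono_iff {a : ℕ → ℕ → ℝ} :
    JointCompMono a ↔ ∀ β n, CompMono (fun m => nabla^[β] (a m) n) := by
  have key : ∀ β₁ β₂ m n, (-1 : ℝ) ^ (β₁ + β₂) * d1^[β₁] (d2^[β₂] a) m n =
      (-1 : ℝ) ^ β₁ * dSeq^[β₁] (fun i => nabla^[β₂] (a i) n) m := by
    intro β₁ β₂ m n
    simp only [← neg_one_pow_mul_dSeq_iterate, d2_iterate, d1_iterate, dSeq_iterate_const_mul]
    ring
  simp only [JointCompMono, key]
  exact ⟨fun h β n k m => h k β m n, fun h β₁ β₂ m n => h β₂ n β₁ m⟩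

theorem nabla_iterate_inv {φ : ℝ} (hφ : 0 < φ) (C : ℝ) (β n : ℕ) :
    nabla^[β] (fun i : ℕ => C * (φ + i)⁻¹) n =
      C * (β.factorial * ∏ i ∈ Finset.range (β + 1), (φ + (n + i : ℕ))⁻¹) := by
  induction β generalizing n with
  | zero => simp
  | succ β ih =>
    rw [nabla_iterate_succ, ih, ih, Finset.prod_range_succ', Finset.prod_range_succ,
      Finset.prod_range_succ', Finset.prod_range_succ]
    have hshift : ∏ i ∈ Finset.range β, (φ + ((n + (i + 1) : ℕ) : ℝ))⁻¹ =
        ∏ i ∈ Finset.range β, (φ + ((n + 1 + i : ℕ) : ℝ))⁻¹ :=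
      Finset.prod_congr rfl fun i _ => by rw [show n + (i + 1) = n + 1 + i by omega]
    rw [hshift, Nat.factorial_succ]
    generalize ∏ i ∈ Finset.range β, (φ + ((n + 1 + i : ℕ) : ℝ))⁻¹ = P
    have h₁ : φ + (n : ℝ) ≠ 0 := by positivity
    have h₂ : φ + ((n : ℝ) + 1 + β) ≠ 0 := by positivity
    push_cast
    rw [add_zero]
    field_simp
    ring

/-- A net `u m / (φ m + n)` with `u` completely monotone and `φ` a positive discrete Bernstein
function is joint completely monotone. -/
theorem jointCompMono_div {u φ : ℕ → ℝ} (hu : CompMono u) (hpos : ∀ m, 0 < φ m)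
    (hφ : CompMono (dSeq φ)) : JointCompMono (fun m n => u m * (φ m + n)⁻¹) := by
  rw [jointCompMono_iff]
  intro β n
  simp only [nabla_iterate_inv (hpos _)]
  refine hu.mul ((CompMono.prod _ fun i _ => CompMono.inv (fun m => ?_) ?_).const_mul
    (Nat.cast_nonneg _))
  · have := hpos m
    positivity
  · convert hφ using 1
    funext m
    simp [dSeq]

theorem prod_eq_prod_ite {F S : Finset ℕ} (h : F ⊆ S) (f : ℕ → ℝ) :
    ∏ j ∈ F, f j = ∏ j ∈ S, if j ∈ F then f j else 1 := by
  rw [Finset.prod_ite_mem, Finset.inter_eq_right.2 h]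

theorem prod_eq_prod_ite_succ {G : Finset ℕ} {k : ℕ} (h : G ⊆ Finset.Icc 2 k) (f : ℕ → ℝ) :
    ∏ j ∈ G, f j = ∏ j ∈ Finset.Icc 1 k, if j + 1 ∈ G then f (j + 1) else 1 := by
  rw [prod_eq_prod_ite (S := Finset.Icc (1 + 1) (k + 1))
    (h.trans (Finset.Icc_subset_Icc le_rfl k.le_succ)), ← Finset.image_add_right_Icc,
    Finset.prod_image (by simp)]

theorem minJointCompMono_of_compMono (k : ℕ) (a₀ b₀ : ℝ) (ha₀ : 0 < a₀) (hb₀ : 0 < b₀)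
    (A B : ℕ → ℝ)
    (hA : ∀ j, 1 ≤ j → j ≤ k → 0 < A j) (hB : ∀ j, 1 ≤ j → j ≤ k → 0 < B j)
    (hBA : ∀ j, 1 ≤ j → j ≤ k → B j ≤ A j)
    (hAB : ∀ j, 1 ≤ j → j < k → A j ≤ B (j + 1)) (c : ℕ → ℝ)
    (hca : CompMono (fun m => c m / ∏ j ∈ Finset.Icc 1 k, ((m : ℝ) + A j)))
    (hcb : VanishingCompMono (fun m => c m / ∏ j ∈ Finset.Icc 1 k, ((m : ℝ) + B j))) :
    MinJointCompMono (fun m n =>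
      c m / (b₀ * ∏ j ∈ Finset.Icc 1 k, ((m : ℝ) + B j) +
        (a₀ * ∏ j ∈ Finset.Icc 1 k, ((m : ℝ) + A j)) * n)) := by
  have hprodpos : ∀ D : ℕ → ℝ, (∀ j, 1 ≤ j → j ≤ k → 0 < D j) → ∀ m : ℕ,
      0 < ∏ j ∈ Finset.Icc 1 k, ((m : ℝ) + D j) := fun D hD m =>
    Finset.prod_pos fun j hj => by
      have := hD j (Finset.mem_Icc.1 hj).1 (Finset.mem_Icc.1 hj).2
      positivity
  have hPA := hprodpos A hA
  have hPB := hprodpos B hB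
  obtain ⟨g, t, hg, -, -, hprod⟩ := PoleCone.exists_prod_ratio k A B hA hBA hAB
  simp only [Finset.prod_div_distrib] at hprod
  have hrewrite : (fun m n : ℕ => c m / (b₀ * ∏ j ∈ Finset.Icc 1 k, ((m : ℝ) + B j) +
        (a₀ * ∏ j ∈ Finset.Icc 1 k, ((m : ℝ) + A j)) * n)) =
      fun m n : ℕ => (a₀⁻¹ * (c m / ∏ j ∈ Finset.Icc 1 k, ((m : ℝ) + A j))) *
        (b₀ / a₀ * ((∏ j ∈ Finset.Icc 1 k, ((m : ℝ) + B j)) /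
          ∏ j ∈ Finset.Icc 1 k, ((m : ℝ) + A j)) + n)⁻¹ := by
    funext m n
    have h₁ := hPA m
    have h₂ := hPB m
    field_simp
  have hφpos : ∀ m : ℕ, 0 < b₀ / a₀ * ((∏ j ∈ Finset.Icc 1 k, ((m : ℝ) + B j)) /
      ∏ j ∈ Finset.Icc 1 k, ((m : ℝ) + A j)) := fun m =>
    mul_pos (div_pos hb₀ ha₀) (div_pos (hPB m) (hPA m))
  refine ⟨?_, fun ε hε => ?_, fun ε hε => ?_⟩
  · rw [hrewrite]
    refine jointCompMono_div (hca.const_mul (inv_pos.2 ha₀).le) hφpos ?_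
    convert hg.compMono.nabla.const_mul (div_pos hb₀ ha₀).le using 1
    funext m
    simp only [dSeq, nabla, hprod]
    ring
  · refine VanishingCompMono.not_compMono_sub ?_ hε
    convert hcb.const_mul (inv_pos.2 hb₀).le using 1
    funext m
    have h₂ := hPB m
    simp only [Nat.cast_zero, mul_zero, add_zero]
    field_simp
  · refine VanishingCompMono.not_compMono_sub ?_ hε
    convert (VanishingCompMono.const
      (mul_nonneg (inv_pos.2 ha₀).le (hca.nonneg 0))).mul_inv_add (hφpos 0) using 1
    funext n
    have h := congrFun (congrFun hrewrite 0) n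
    refine h.trans ?_
    rw [add_comm (n : ℝ)]

theorem statement10 (k : ℕ) (hk : 0 < k) (a₀ b₀ : ℝ) (ha₀ : 0 < a₀) (hb₀ : 0 < b₀)
    (A B : ℕ → ℝ)
    (hA : ∀ j, 1 ≤ j → j ≤ k → 0 < A j) (hB : ∀ j, 1 ≤ j → j ≤ k → 0 < B j)
    (hBA : ∀ j, 1 ≤ j → j ≤ k → B j ≤ A j)
    (hAB : ∀ j, 1 ≤ j → j < k → A j ≤ B (j + 1))
    (F G : Finset ℕ) (hF : F ⊆ Finset.Icc 1 k) (hG : G ⊆ Finset.Icc 2 k)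
    (c : ℝ → ℝ)
    (hc : (∀ x : ℝ, c x = ∏ j ∈ F, (x + A j)) ∨ (∀ x : ℝ, c x = ∏ j ∈ G, (x + B j))) :
    MinJointCompMono (fun m n =>
      c m / (b₀ * ∏ j ∈ Finset.Icc 1 k, ((m : ℝ) + B j) +
        (a₀ * ∏ j ∈ Finset.Icc 1 k, ((m : ℝ) + A j)) * n)) := by
  have hmem : ∀ {j}, j ∈ Finset.Icc 1 k → 1 ≤ j ∧ j ≤ k := Finset.mem_Icc.1
  have hA' : ∀ j ∈ Finset.Icc 1 k, 0 < A j := fun j hj => hA j (hmem hj).1 (hmem hj).2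
  have hB' : ∀ j ∈ Finset.Icc 1 k, 0 < B j := fun j hj => hB j (hmem hj).1 (hmem hj).2
  refine minJointCompMono_of_compMono k a₀ b₀ ha₀ hb₀ A B hA hB hBA hAB (fun m => c m) ?_ ?_
  · rcases hc with hc | hc
    · simp only [hc, prod_eq_prod_ite hF, ← Finset.prod_div_distrib]
      exact (VanishingCompMono.prod_ratio _ (· ∈ F) A A hA' fun _ _ _ => le_rfl).1
    · simp only [hc, prod_eq_prod_ite_succ hG, ← Finset.prod_div_distrib]
      refine (VanishingCompMono.prod_ratio _ (· + 1 ∈ G) (fun j => B (j + 1)) A hA'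
        fun j hj hjG => hAB j (hmem hj).1 ?_).1
      have := (Finset.mem_Icc.1 (hG hjG)).2
      omega
  · rcases hc with hc | hc
    · simp only [hc, prod_eq_prod_ite hF, ← Finset.prod_div_distrib]
      exact VanishingCompMono.prod_ratio _ (· ∈ F) A B hB'
        fun j hj _ => hBA j (hmem hj).1 (hmem hj).2
    · simp only [hc, prod_eq_prod_ite (hG.trans (Finset.Icc_subset_Icc one_le_two le_rfl)),
        ← Finset.prod_div_distrib]
      exact VanishingCompMono.prod_ratio _ (· ∈ G) B B hB' fun _ _ _ => le_rfl
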